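/- Let P be an r-differential poset and R a field of characteristic 0. Then the characteristic polynomial of DU_n equals ∏_{i=0}^{n} (x − r(i+1))^{Δp_{n−i}} and the characteristic polynomial of UD_n equals ∏_{i=0}^{n} (x − ri)^{Δp_{n−i}}, where Δp_n := p_n − p_{n−1}. Furthermore, the operators DU_n and UD_n are diagonalizable over R. -/

import Mathlib

open Polynomial

/-- A rectangular matrix over a commutative ring has Smith normal form: there are
invertible matrices `P`, `Q` such that `P * A * Q` is diagonal with diagonal entries
forming a divisibility chain. -/
def Matrix.HasSNF {R : Type*} [CommRing R] {m n : ℕ} (A : Matrix (Fin m) (Fin n) R) : Prop :=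
  ∃ (P : Matrix (Fin m) (Fin m) R) (Q : Matrix (Fin n) (Fin n) R),
    IsUnit P ∧ IsUnit Q ∧
    (∀ (i : Fin m) (j : Fin n), (i : ℕ) ≠ (j : ℕ) → (P * A * Q) i j = 0) ∧
    (∀ (i : ℕ) (h₁ : i + 1 < m) (h₂ : i + 1 < n),
      (P * A * Q) ⟨i, Nat.lt_of_succ_lt h₁⟩ ⟨i, Nat.lt_of_succ_lt h₂⟩ ∣
        (P * A * Q) ⟨i + 1, h₁⟩ ⟨i + 1, h₂⟩)

/-- SNF for matrices with arbitrary finite index types. -/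
def Matrix.HasSNF' {ι κ R : Type*} [Fintype ι] [Fintype κ] [CommRing R]
    (A : Matrix ι κ R) : Prop :=
  ∃ (eι : ι ≃ Fin (Fintype.card ι)) (eκ : κ ≃ Fin (Fintype.card κ)),
    Matrix.HasSNF (Matrix.reindex eι eκ A)
/-- An endomorphism `φ` of a `ℤ`-module `M` (equivalently, the `ℤ[x]`-module `(M, φ)` where
`x` acts as `φ`) has rational canonical form over `ℤ`: `M` is an internal direct sum of
cyclic `ℤ[x]`-submodules whose annihilators are generated by monic non-constant polynomials
`a_1 ∣ a_2 ∣ ... ∣ a_k`. -/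
def Module.End.HasRCF {M : Type*} [AddCommGroup M] [Module ℤ M] (φ : Module.End ℤ M) : Prop :=
  ∃ (k : ℕ) (V : Fin k → Submodule ℤ[X] (Module.AEval' φ)) (a : Fin k → ℤ[X]),
    (∀ i, (a i).Monic) ∧ (∀ i, 0 < (a i).natDegree) ∧
    (∀ i j : Fin k, i ≤ j → a i ∣ a j) ∧
    (∀ i, ∃ v : Module.AEval' φ, V i = Submodule.span ℤ[X] {v}) ∧
    (∀ i, (V i).annihilator = Ideal.span {a i}) ∧
    DirectSum.IsInternal V
/-- An `r`-differential poset. -/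
structure DiffPoset (r : ℕ) where
  P : Type
  [po : PartialOrder P]
  locallyFinite : ∀ x y : P, (Set.Icc x y).Finite
  rk : P → ℕ
  fiberFinite : ∀ n : ℕ, {x : P | rk x = n}.Finite
  bot : P
  bot_le : ∀ x : P, bot ≤ x
  rk_bot : rk bot = 0
  rk_covBy : ∀ {x y : P}, x ⋖ y → rk y = rk x + 1
  d2 : ∀ {x y : P}, x ≠ y →
      {z : P | z ⋖ x ∧ z ⋖ y}.ncard = {z : P | x ⋖ z ∧ y ⋖ z}.ncard
  d3 : ∀ x : P, {z : P | x ⋖ z}.ncard = {z : P | z ⋖ x}.ncard + r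

attribute [instance] DiffPoset.po

namespace DiffPoset

variable {r : ℕ} (D : DiffPoset r)

/-- The `n`-th rank `P_n` of the poset. -/
abbrev level (n : ℕ) : Type := {x : D.P // D.rk x = n}

noncomputable instance (n : ℕ) : Fintype (D.level n) := (D.fiberFinite n).fintype

noncomputable instance (n : ℕ) : DecidableEq (D.level n) := Classical.decEq _

noncomputable instance (x y : D.P) : Decidable (x ⋖ y) := Classical.dec _

/-- The rank size `p_n`. -/
noncomputable def p (n : ℕ) : ℕ := Fintype.card (D.level n)

/-- The matrix of the up map `U_n` in the standard basis. -/
noncomputable def upMatrix (R : Type*) [CommRing R] (n : ℕ) :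
    Matrix (D.level (n + 1)) (D.level n) R :=
  fun y x => if (x : D.P) ⋖ (y : D.P) then 1 else 0

/-- The matrix of the down map `D_{n+1}` in the standard basis. -/
noncomputable def downMatrix (R : Type*) [CommRing R] (n : ℕ) :
    Matrix (D.level n) (D.level (n + 1)) R :=
  fun y x => if (y : D.P) ⋖ (x : D.P) then 1 else 0

/-- The up map `U_n : RP_n → RP_{n+1}`. -/
noncomputable def up (R : Type*) [CommRing R] (n : ℕ) :
    (D.level n → R) →ₗ[R] (D.level (n + 1) → R) :=
  (D.upMatrix R n).mulVecLin

/-- The down map `D_{n+1} : RP_{n+1} → RP_n`. -/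
noncomputable def down (R : Type*) [CommRing R] (n : ℕ) :
    (D.level (n + 1) → R) →ₗ[R] (D.level n → R) :=
  (D.downMatrix R n).mulVecLin

/-- The operator `DU_n = D_{n+1} ∘ U_n`. -/
noncomputable def du (R : Type*) [CommRing R] (n : ℕ) :
    Module.End R (D.level n → R) :=
  (D.down R n) ∘ₗ (D.up R n)

/-- The matrix `[DU_n]` in the standard basis. -/
noncomputable def duMatrix (R : Type*) [CommRing R] (n : ℕ) :
    Matrix (D.level n) (D.level n) R :=
  D.downMatrix R n * D.upMatrix R n

/-- The operator `UD_n = U_{n-1} ∘ D_n` (zero for `n = 0`). -/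
noncomputable def ud (R : Type*) [CommRing R] : (n : ℕ) → Module.End R (D.level n → R)
  | 0 => 0
  | (n + 1) => (D.up R n) ∘ₗ (D.down R n)

/-- The matrix `[UD_n]` in the standard basis (zero for `n = 0`). -/
noncomputable def udMatrix (R : Type*) [CommRing R] :
    (n : ℕ) → Matrix (D.level n) (D.level n) R
  | 0 => 0
  | (n + 1) => D.upMatrix R n * D.downMatrix R n

/-- The rank size difference `Δp_n = p_n - p_{n-1}` (with `p_{-1} = 0`), as an integer. -/
noncomputable def dp : ℕ → ℤ
  | 0 => (D.p 0 : ℤ)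
  | (n + 1) => (D.p (n + 1) : ℤ) - (D.p n : ℤ)

/-- The rank size difference `Δp_n = p_n - p_{n-1}` (with `p_{-1} = 0`), as a natural number. -/
noncomputable def dpN : ℕ → ℕ
  | 0 => D.p 0
  | (n + 1) => D.p (n + 1) - D.p n

end DiffPoset

namespace DiffPoset

variable {r : ℕ} (D : DiffPoset r)

theorem card_level_filter {n : ℕ} (q : D.P → Prop) [DecidablePred q]
    (h : ∀ z, q z → D.rk z = n) :
    (Finset.univ.filter fun z : D.level n => q z).card = {z : D.P | q z}.ncard := by
  rw [← Set.ncard_coe_finset, ← Set.ncard_image_of_injective _ Subtype.val_injective]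
  congr 1
  ext z
  simpa using h z

theorem duMatrix_apply (R : Type*) [CommRing R] (n : ℕ) (x y : D.level n) :
    D.duMatrix R n x y = ({z : D.P | (x : D.P) ⋖ z ∧ (y : D.P) ⋖ z}.ncard : R) := by
  classical
  rw [← D.card_level_filter (n := n + 1) _ fun z hz => by rw [D.rk_covBy hz.1, x.2]]
  simp [duMatrix, Matrix.mul_apply, downMatrix, upMatrix, ← ite_and, and_comm]

theorem udMatrix_apply (R : Type*) [CommRing R] (n : ℕ) (x y : D.level n) :
    D.udMatrix R n x y = ({z : D.P | z ⋖ (x : D.P) ∧ z ⋖ (y : D.P)}.ncard : R) := by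
  classical
  cases n with
  | zero =>
    have h : {z : D.P | z ⋖ (x : D.P) ∧ z ⋖ (y : D.P)} = ∅ :=
      Set.eq_empty_of_forall_notMem fun z hz => by
        have := D.rk_covBy hz.1
        rw [x.2] at this
        omega
    simp [h, udMatrix]
  | succ n =>
    rw [← D.card_level_filter (n := n) _ fun z hz => by
      have := D.rk_covBy hz.1
      rw [x.2] at this
      omega]
    simp [udMatrix, Matrix.mul_apply, downMatrix, upMatrix, ← ite_and, and_comm]

/-- The commutation relation `DU_n = UD_n + r`. -/
theorem duMatrix_eq (R : Type*) [CommRing R] (n : ℕ) :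
    D.duMatrix R n = D.udMatrix R n + Matrix.scalar _ (r : R) := by
  ext x y
  rw [Matrix.add_apply, duMatrix_apply, udMatrix_apply, Matrix.scalar_apply,
    Matrix.diagonal_apply]
  obtain rfl | h := eq_or_ne x y
  · simp [D.d3]
  · rw [D.d2 fun e => h (Subtype.ext e)]
    simp [h]

theorem du_eq_mulVecLin (R : Type*) [CommRing R] (n : ℕ) :
    D.du R n = (D.duMatrix R n).mulVecLin :=
  (Matrix.mulVecLin_mul _ _).symm

theorem ud_eq_mulVecLin (R : Type*) [CommRing R] (n : ℕ) :
    D.ud R n = (D.udMatrix R n).mulVecLin := by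
  cases n with
  | zero => simp [ud, udMatrix]
  | succ n => exact (Matrix.mulVecLin_mul _ _).symm

theorem du_apply (R : Type*) [CommRing R] (n : ℕ) (v : D.level n → R) :
    D.du R n v = D.ud R n v + (r : R) • v := by
  rw [du_eq_mulVecLin, ud_eq_mulVecLin, duMatrix_eq]
  ext
  simp

theorem charpoly_duMatrix (R : Type*) [CommRing R] (n : ℕ) :
    (D.duMatrix R n).charpoly = (D.udMatrix R n).charpoly.comp (X - C (r : R)) := by
  rw [duMatrix_eq, sub_eq_add_neg, ← C_neg, ← Matrix.charpoly_sub_scalar, map_neg, sub_neg_eq_add]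

theorem charpoly_udMatrix_succ (R : Type*) [Field R] (n : ℕ) (h : IsUnit (D.duMatrix R n)) :
    (D.udMatrix R (n + 1)).charpoly = X ^ D.dpN (n + 1) * (D.duMatrix R n).charpoly := by
  have hle : D.p n ≤ D.p (n + 1) := by
    have h1 := Matrix.rank_of_isUnit _ h
    have h2 := (Matrix.rank_mul_le_right (D.downMatrix R n) (D.upMatrix R n)).trans
      (Matrix.rank_le_card_height _)
    rw [duMatrix] at h1
    rw [h1] at h2
    exact h2
  exact Matrix.charpoly_mul_comm_of_le _ _ hle

theorem charpoly_duMatrix_of_udMatrix (R : Type*) [CommRing R] (n : ℕ)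
    (h : (D.udMatrix R n).charpoly =
      ∏ i ∈ Finset.range (n + 1), (X - C ((r : R) * (i : R))) ^ (D.dpN (n - i))) :
    (D.duMatrix R n).charpoly =
      ∏ i ∈ Finset.range (n + 1), (X - C ((r : R) * ((i : R) + 1))) ^ (D.dpN (n - i)) := by
  rw [charpoly_duMatrix, h, prod_comp]
  refine Finset.prod_congr rfl fun i _ => ?_
  simp only [pow_comp, sub_comp, X_comp, C_comp, mul_add, mul_one, C_add]
  ring

theorem isUnit_duMatrix_of_charpoly (hr : 0 < r) (R : Type*) [Field R] [CharZero R] (n : ℕ)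
    (h : (D.duMatrix R n).charpoly =
      ∏ i ∈ Finset.range (n + 1), (X - C ((r : R) * ((i : R) + 1))) ^ (D.dpN (n - i))) :
    IsUnit (D.duMatrix R n) := by
  rw [Matrix.isUnit_iff_isUnit_det, isUnit_iff_ne_zero, Matrix.det_eq_sign_charpoly_coeff, h,
    coeff_zero_eq_eval_zero, eval_prod]
  refine mul_ne_zero (pow_ne_zero _ (by simp)) (Finset.prod_ne_zero_iff.mpr fun i _ => ?_)
  have : (r : R) * ((i : R) + 1) ≠ 0 :=
    mul_ne_zero (Nat.cast_ne_zero.mpr hr.ne') (Nat.cast_add_one_ne_zero i)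
  simpa using pow_ne_zero _ (neg_ne_zero.mpr this)

theorem charpoly_udMatrix (hr : 0 < r) (R : Type*) [Field R] [CharZero R] (n : ℕ) :
    (D.udMatrix R n).charpoly =
      ∏ i ∈ Finset.range (n + 1), (X - C ((r : R) * (i : R))) ^ (D.dpN (n - i)) := by
  induction n with
  | zero => simp [udMatrix, dpN, p]
  | succ n ih =>
    have h := D.charpoly_duMatrix_of_udMatrix R n ih
    rw [D.charpoly_udMatrix_succ R n (D.isUnit_duMatrix_of_charpoly hr R n h), h,
      Finset.prod_range_succ' _ (n + 1), mul_comm]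
    simp

theorem isUnit_duMatrix (hr : 0 < r) (R : Type*) [Field R] [CharZero R] (n : ℕ) :
    IsUnit (D.duMatrix R n) :=
  D.isUnit_duMatrix_of_charpoly hr R n
    (D.charpoly_duMatrix_of_udMatrix R n (D.charpoly_udMatrix hr R n))

theorem iSup_eigenspace_du (R : Type*) [Field R] (n : ℕ)
    (h : ⨆ μ : R, Module.End.eigenspace (D.ud R n) μ = ⊤) :
    ⨆ μ : R, Module.End.eigenspace (D.du R n) μ = ⊤ := by
  rw [eq_top_iff, ← h]
  refine iSup_le fun μ v hv => Submodule.mem_iSup_of_mem (μ + r) ?_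
  rw [Module.End.mem_eigenspace_iff] at hv ⊢
  rw [du_apply, hv, add_smul]

theorem iSup_eigenspace_ud (hr : 0 < r) (R : Type*) [Field R] [CharZero R] (n : ℕ) :
    ⨆ μ : R, Module.End.eigenspace (D.ud R n) μ = ⊤ := by
  induction n with
  | zero =>
    rw [eq_top_iff]
    exact fun v _ => Submodule.mem_iSup_of_mem 0 (by simp [ud])
  | succ n ih =>
    have hU : ∀ w, D.up R n w ∈ ⨆ μ : R, Module.End.eigenspace (D.ud R (n + 1)) μ := by
      intro w
      have hw : D.up R n w ∈ (⨆ μ : R, Module.End.eigenspace (D.du R n) μ).map (D.up R n) := by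
        rw [D.iSup_eigenspace_du R n ih]
        exact Submodule.mem_map_of_mem trivial
      rw [Submodule.map_iSup] at hw
      refine SetLike.le_def.mp (iSup_mono fun μ => ?_) hw
      rintro _ ⟨v, hv, rfl⟩
      rw [SetLike.mem_coe, Module.End.mem_eigenspace_iff] at hv
      rw [Module.End.mem_eigenspace_iff, ← map_smul, ← hv]
      rfl
    rw [eq_top_iff]
    intro v _
    obtain ⟨w, hw⟩ := Matrix.mulVec_surjective_iff_isUnit.mpr (D.isUnit_duMatrix hr R n)
      (D.down R n v)
    have hw : D.down R n (D.up R n w) = D.down R n v :=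
      (LinearMap.congr_fun (D.du_eq_mulVecLin R n) w).trans hw
    rw [← add_sub_cancel (D.up R n w) v]
    refine add_mem (hU w) (Submodule.mem_iSup_of_mem 0 ?_)
    rw [Module.End.mem_eigenspace_iff, zero_smul]
    change D.up R n (D.down R n _) = 0
    rw [map_sub, hw, sub_self, map_zero]

end DiffPoset

/-- **Stanley.** For an `r`-differential poset and a field `R` of
characteristic `0`, the characteristic polynomials of `DU_n` and `UD_n` are
`∏_{i=0}^{n} (x − r(i+1))^{Δp_{n−i}}` and `∏_{i=0}^{n} (x − ri)^{Δp_{n−i}}` respectively,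
and both operators are diagonalizable. -/
theorem charpoly_du_ud {r : ℕ} (hr : 0 < r) (D : DiffPoset r)
    (R : Type) [Field R] [CharZero R] (n : ℕ) :
    (D.duMatrix R n).charpoly =
        ∏ i ∈ Finset.range (n + 1), (X - C ((r : R) * ((i : R) + 1))) ^ (D.dpN (n - i)) ∧
    (D.udMatrix R n).charpoly =
        ∏ i ∈ Finset.range (n + 1), (X - C ((r : R) * (i : R))) ^ (D.dpN (n - i)) ∧
    (⨆ μ : R, Module.End.eigenspace (D.du R n) μ) = ⊤ ∧
    (⨆ μ : R, Module.End.eigenspace (D.ud R n) μ) = ⊤ := by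
  have h := D.charpoly_udMatrix hr R n
  have hs := D.iSup_eigenspace_ud hr R n
  exact ⟨D.charpoly_duMatrix_of_udMatrix R n h, h, D.iSup_eigenspace_du R n hs, hs⟩
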